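/- Let K and L be convex bodies in ℝ⁴ having countably many diameters, with a common diameter direction ζ ∈ S³, such that for every w ∈ S²(ζ) the projections K|w^⊥ and L|w^⊥ are directly congruent. Let a_K, a_L ∈ ℝ⁴ be translation vectors such that the diameters of K̃ = K + a_K and L̃ = L + a_L parallel to ζ coincide and are centered at the origin. Then for every w ∈ Ω = {w ∈ S²(ζ) : (A_K ∪ A_L) ∩ S²(w) = {±ζ}} and every rotation χ_w ∈ SO(3, S²(w)) with χ_w(K|w^⊥) = L|w^⊥ + a_w (a_w ∈ w^⊥), the transposed rotation φ_w := (χ_w)^t satisfies φ_w(ζ) = ±ζ and h_{K̃}(φ_w(θ)) = h_{L̃}(θ) for all θ ∈ S²(w). -/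

import Mathlib

noncomputable section

open scoped RealInnerProductSpace

/-- `ℝ⁴` as a Euclidean space. -/
abbrev E4 := EuclideanSpace ℝ (Fin 4)

/-- The unit sphere `S³` in `ℝ⁴`. -/
def sph : Set E4 := Metric.sphere (0 : E4) 1

/-- The great subsphere `S²(w) = {θ ∈ S³ : θ·w = 0}`. -/
def S2 (w : E4) : Set E4 := {θ ∈ sph | ⟪θ, w⟫ = 0}

/-- The orthogonal transformation `𝒪` determined by `ζ`: for a unit vector `ζ` the map
`x ↦ 2⟪x,ζ⟫ζ - x` satisfies `𝒪 ζ = ζ` and `𝒪 = -I` on `ζ^⊥`. -/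
def Ocal (ζ x : E4) : E4 := (2 * ⟪x, ζ⟫) • ζ - x

/-- `φ` is (the extension to `ℝ⁴` of) an element of `SO(3, S²(w))`:
a linear isometry of `ℝ⁴` fixing `w`, of determinant `1`, i.e. a rotation
of the `3`-dimensional subspace `w^⊥`. -/
def IsRot (w : E4) (φ : E4 ≃ₗᵢ[ℝ] E4) : Prop :=
  φ w = w ∧ LinearMap.det (φ.toLinearEquiv : E4 →ₗ[ℝ] E4) = 1

/-- `φ ∈ SO(3, S²(w))` is a rotation by the angle `α·π` around the axis `u ∈ S²(w)`:
it fixes `w` and `u`, and turns the plane orthogonal to `w` and `u` by the angle `α·π`. -/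
def IsRotAngleAbout (w u : E4) (α : ℝ) (φ : E4 ≃ₗᵢ[ℝ] E4) : Prop :=
  IsRot w φ ∧ φ u = u ∧
    ∀ v : E4, ⟪v, w⟫ = 0 → ⟪v, u⟫ = 0 →
      ⟪φ v, v⟫ = Real.cos (α * Real.pi) * ⟪v, v⟫

/-- The support function of `K`. -/
def suppFn (K : Set E4) (x : E4) : ℝ := sSup ((fun y => ⟪x, y⟫) '' K)

/-- The width function of `K`. -/
def widthFn (K : Set E4) (x : E4) : ℝ := suppFn K x + suppFn K (-x)

/-- The maximal width of `K`. -/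
def maxWidth (K : Set E4) : ℝ := sSup (widthFn K '' sph)

/-- Directions of diameters of a convex body `K`: the set of `θ ∈ S³` at which the
width function attains its maximum. -/
def DiamDirs (K : Set E4) : Set E4 := {θ ∈ sph | widthFn K θ = maxWidth K}

/-- Orthogonal projection onto the hyperplane `w^⊥` (for a unit vector `w`). -/
def projHyp (w x : E4) : E4 := x - ⟪x, w⟫ • w

/-- A convex body: a compact convex set with nonempty interior. -/
def IsConvexBody (K : Set E4) : Prop := IsCompact K ∧ Convex ℝ K ∧ (interior K).Nonempty

/-- Subsets `D₁`, `D₂` of `w^⊥` are directly congruent: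
`φ(D₁) = D₂ + a` for some rotation `φ ∈ SO(3, w^⊥)` and some `a ∈ w^⊥`. -/
def DirCong (w : E4) (D₁ D₂ : Set E4) : Prop :=
  ∃ φ : E4 ≃ₗᵢ[ℝ] E4, IsRot w φ ∧
    ∃ a : E4, ⟪a, w⟫ = 0 ∧ φ '' D₁ = (fun x => x + a) '' D₂

/-- The subset `D` of the `3`-dimensional subspace `w^⊥` has a `(u, π)`-symmetry:
`φ(D) = D + a` for the rotation `φ` by the angle `π` about `u` and some `a ∈ w^⊥`. -/
def HasPiSymSet (w u : E4) (D : Set E4) : Prop :=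
  ∃ φ : E4 ≃ₗᵢ[ℝ] E4, IsRotAngleAbout w u 1 φ ∧
    ∃ a : E4, ⟪a, w⟫ = 0 ∧ φ '' D = (fun x => x + a) '' D

/-- The subset `D` of `ζ^⊥` has a rigid motion symmetry: `φ(D) = D + a` for some
non-identical orthogonal transformation `φ ∈ O(3, ζ^⊥)` and some `a ∈ ζ^⊥`. -/
def HasRigidSym (ζ : E4) (D : Set E4) : Prop :=
  ∃ φ : E4 ≃ₗᵢ[ℝ] E4, φ ζ = ζ ∧ (∃ x : E4, ⟪x, ζ⟫ = 0 ∧ φ x ≠ x) ∧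
    ∃ a : E4, ⟪a, ζ⟫ = 0 ∧ φ '' D = (fun x => x + a) '' D

/-- A diameter of a convex body `K`: a chord of `K` realizing the maximal width. -/
def IsDiamSeg (K : Set E4) (z y : E4) : Prop :=
  segment ℝ z y ⊆ K ∧ dist z y = maxWidth K

/-- The set `Ω = {w ∈ S²(ζ) : (A_K ∪ A_L) ∩ S²(w) = {±ζ}}`, where `A_K`, `A_L` are
the sets of directions of diameters of `K` and `L`. -/
def Omega (K L : Set E4) (ζ : E4) : Set E4 :=
  {w ∈ S2 ζ | (DiamDirs K ∪ DiamDirs L) ∩ S2 w = {ζ, -ζ}}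

lemma IsCompact.bddAbove_inner_image {K : Set E4} (hK : IsCompact K) (x : E4) :
    BddAbove ((fun y => ⟪x, y⟫) '' K) :=
  (hK.image (by fun_prop)).bddAbove

lemma inner_le_suppFn {K : Set E4} (hK : IsCompact K) (x : E4) {y : E4} (hy : y ∈ K) :
    ⟪x, y⟫ ≤ suppFn K x :=
  le_csSup (hK.bddAbove_inner_image x) ⟨y, hy, rfl⟩

lemma suppFn_translate {K : Set E4} (hK : IsCompact K) (hne : K.Nonempty) (c x : E4) :
    suppFn ((fun y => y + c) '' K) x = suppFn K x + ⟪x, c⟫ := by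
  have hlub : IsLUB ((fun y => ⟪x, y⟫) '' K) (suppFn K x) :=
    isLUB_csSup (hne.image _) (hK.bddAbove_inner_image x)
  have h : IsLUB ((fun y => ⟪x, y⟫) '' ((fun y => y + c) '' K)) (suppFn K x + ⟪x, c⟫) := by
    constructor
    · rintro _ ⟨_, ⟨y, hy, rfl⟩, rfl⟩
      have := hlub.1 ⟨y, hy, rfl⟩
      simp only [inner_add_right]
      linarith
    · intro B hB
      have : suppFn K x ≤ B - ⟪x, c⟫ := hlub.2 (by
        rintro _ ⟨y, hy, rfl⟩
        have := hB ⟨_, ⟨y, hy, rfl⟩, rfl⟩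
        simp only [inner_add_right] at this
        simp only
        linarith)
      linarith
  exact h.csSup_eq ((hne.image _).image _)

lemma widthFn_translate {K : Set E4} (hK : IsCompact K) (hne : K.Nonempty) (c x : E4) :
    widthFn ((fun y => y + c) '' K) x = widthFn K x := by
  simp only [widthFn, suppFn_translate hK hne, inner_neg_left]
  ring

lemma maxWidth_translate {K : Set E4} (hK : IsCompact K) (hne : K.Nonempty) (c : E4) :
    maxWidth ((fun y => y + c) '' K) = maxWidth K := by
  have : widthFn ((fun y => y + c) '' K) = widthFn K :=
    funext (widthFn_translate hK hne c)
  rw [maxWidth, maxWidth, this]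

lemma inner_projHyp {w x : E4} (hx : ⟪x, w⟫ = 0) (y : E4) : ⟪x, projHyp w y⟫ = ⟪x, y⟫ := by
  simp [projHyp, inner_sub_right, inner_smul_right, hx]

lemma suppFn_projHyp (K : Set E4) {w x : E4} (hx : ⟪x, w⟫ = 0) :
    suppFn (projHyp w '' K) x = suppFn K x := by
  simp only [suppFn, Set.image_image, inner_projHyp hx]

lemma suppFn_isometry_image (K : Set E4) (χ : E4 ≃ₗᵢ[ℝ] E4) (x : E4) :
    suppFn (χ '' K) x = suppFn K (χ.symm x) := by
  have : ∀ y, ⟪x, χ y⟫ = ⟪χ.symm x, y⟫ := fun y => by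
    rw [← χ.inner_map_map (χ.symm x) y, χ.apply_symm_apply]
  simp only [suppFn, Set.image_image, this]

lemma continuous_projHyp (w : E4) : Continuous (projHyp w) := by
  unfold projHyp
  fun_prop

lemma bddAbove_widthFn_image_sph {K : Set E4} (hK : IsCompact K) (hne : K.Nonempty) :
    BddAbove (widthFn K '' sph) := by
  obtain ⟨C, hC⟩ := hK.isBounded.exists_norm_le
  have key : ∀ x ∈ sph, suppFn K x ≤ C := by
    intro x hx
    refine csSup_le (hne.image _) ?_
    rintro _ ⟨y, hy, rfl⟩
    have hx1 : ‖x‖ = 1 := by simpa [sph] using hx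
    have := real_inner_le_norm x y
    rw [hx1, one_mul] at this
    exact this.trans (hC y hy)
  refine ⟨C + C, ?_⟩
  rintro _ ⟨x, hx, rfl⟩
  exact add_le_add (key x hx) (key (-x) (by simpa [sph] using hx))

lemma dist_le_maxWidth {K : Set E4} (hK : IsCompact K) {x y : E4} (hx : x ∈ K) (hy : y ∈ K)
    (hxy : x ≠ y) : dist x y ≤ maxWidth K := by
  have hn : ‖x - y‖ ≠ 0 := norm_ne_zero_iff.2 (sub_ne_zero.2 hxy)
  set u : E4 := ‖x - y‖⁻¹ • (x - y) with hu
  have hus : u ∈ sph := by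
    simp [sph, hu, norm_smul, hn]
  have h1 : widthFn K u ≤ maxWidth K :=
    le_csSup (bddAbove_widthFn_image_sph hK ⟨x, hx⟩) ⟨u, hus, rfl⟩
  have h2 := inner_le_suppFn hK u hx
  have h3 := inner_le_suppFn hK (-u) hy
  have h4 : ⟪u, x⟫ + ⟪-u, y⟫ = ‖x - y‖ := by
    rw [inner_neg_left, ← sub_eq_add_neg, ← inner_sub_right, hu, real_inner_smul_left,
      real_inner_self_eq_norm_sq]
    field_simp
  rw [dist_eq_norm]
  unfold widthFn at h1
  linarith

/-- A body of maximal width `2r` containing `-ru` meets the hyperplane `{x | ⟪x, u⟫ = r}` at most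
in `ru`. -/
lemma eq_smul_of_inner_eq {K : Set E4} (hK : IsCompact K) {r : ℝ} (hr : 0 < r) {u : E4}
    (hu : ‖u‖ = 1) (hmax : maxWidth K = 2 * r) (hmem : -(r • u) ∈ K) {x : E4} (hx : x ∈ K)
    (hxu : ⟪x, u⟫ = r) : x = r • u := by
  have huu : ⟪u, u⟫ = 1 := by rw [real_inner_self_eq_norm_sq, hu]; norm_num
  have hne : x ≠ -(r • u) := by
    rintro rfl
    rw [inner_neg_left, real_inner_smul_left, huu] at hxu
    linarith
  have hd := dist_le_maxWidth hK hx hmem hne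
  rw [dist_eq_norm, hmax, sub_neg_eq_add] at hd
  have hsq : ‖x + r • u‖ ^ 2 ≤ (2 * r) ^ 2 := by gcongr
  have hru : ‖r • u‖ = r := by rw [norm_smul, hu, Real.norm_of_nonneg hr.le, mul_one]
  have h1 := norm_add_sq_real x (r • u)
  have h2 := norm_sub_sq_real x (r • u)
  rw [real_inner_smul_right, hxu, hru] at h1 h2
  have : ‖x - r • u‖ ^ 2 ≤ 0 := by nlinarith
  have h0 : ‖x - r • u‖ = 0 := by
    have := sq_nonneg ‖x - r • u‖
    exact pow_eq_zero_iff two_ne_zero |>.1 (le_antisymm ‹_› this)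
  exact sub_eq_zero.1 (norm_eq_zero.1 h0)

/-- A body of maximal width `2r` attained in direction `u` with diameter `[-ru, ru]` is supported
at height `r` in direction `u`. -/
lemma suppFn_eq_of_diam {K : Set E4} (hK : IsCompact K) {r : ℝ} {u : E4} (hu : ‖u‖ = 1)
    (hwidth : widthFn K u = 2 * r) (hneg : -(r • u) ∈ K) (hpos : r • u ∈ K) :
    suppFn K u = r := by
  have huu : ⟪u, u⟫ = 1 := by rw [real_inner_self_eq_norm_sq, hu]; norm_num
  have h1 := inner_le_suppFn hK u hpos
  have h2 := inner_le_suppFn hK (-u) hneg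
  rw [inner_neg_neg, real_inner_smul_right, huu] at h2
  rw [real_inner_smul_right, huu] at h1
  unfold widthFn at hwidth
  linarith

/-- Lemma: after translating the diameters to be centered at the
origin, the transposed rotations carry the support function of `K̃` to that of `L̃`. -/
theorem stmt_12 (K L : Set E4) (hK : IsConvexBody K) (hL : IsConvexBody L)
    (hKc : (DiamDirs K).Countable) (hLc : (DiamDirs L).Countable)
    (ζ : E4) (hζ : ζ ∈ sph) (hζK : ζ ∈ DiamDirs K) (hζL : ζ ∈ DiamDirs L)
    (hcong : ∀ w ∈ S2 ζ, DirCong w (projHyp w '' K) (projHyp w '' L))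
    (aK aL : E4)
    (hdiam : ∃ r : ℝ, 0 < r ∧
      IsDiamSeg ((fun x => x + aK) '' K) (-(r • ζ)) (r • ζ) ∧
      IsDiamSeg ((fun x => x + aL) '' L) (-(r • ζ)) (r • ζ)) :
    ∀ w ∈ Omega K L ζ, ∀ (χ : E4 ≃ₗᵢ[ℝ] E4) (a : E4), IsRot w χ → ⟪a, w⟫ = 0 →
      χ '' (projHyp w '' K) = (fun x => x + a) '' (projHyp w '' L) →
      ((χ.symm ζ = ζ ∨ χ.symm ζ = -ζ) ∧
        ∀ θ ∈ S2 w, suppFn ((fun x => x + aK) '' K) (χ.symm θ) =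
          suppFn ((fun x => x + aL) '' L) θ) := by
  obtain ⟨r, hr, ⟨hKseg, hKdist⟩, hLseg, hLdist⟩ := hdiam
  have hKne : K.Nonempty := hK.2.2.mono interior_subset
  have hLne : L.Nonempty := hL.2.2.mono interior_subset
  have hKt : IsCompact ((fun x => x + aK) '' K) := hK.1.image (by fun_prop)
  have hLt : IsCompact ((fun x => x + aL) '' L) := hL.1.image (by fun_prop)
  have hζ1 : ‖ζ‖ = 1 := by simpa [sph] using hζ
  have hdist : dist (-(r • ζ)) (r • ζ) = 2 * r := by
    have : -(r • ζ) - r • ζ = (-(2 * r)) • ζ := by module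
    rw [dist_eq_norm, this, norm_smul, hζ1, norm_neg, Real.norm_of_nonneg (by positivity), mul_one]
  rw [hdist] at hKdist hLdist
  have hKneg := hKseg (left_mem_segment ℝ _ _)
  have hKpos := hKseg (right_mem_segment ℝ _ _)
  have hLneg := hLseg (left_mem_segment ℝ _ _)
  have hLpos := hLseg (right_mem_segment ℝ _ _)
  have hKmax : maxWidth K = 2 * r := by rw [hKdist, maxWidth_translate hK.1 hKne]
  have hLmax : maxWidth L = 2 * r := by rw [hLdist, maxWidth_translate hL.1 hLne]
  intro w hw χ a hχ ha himg
  obtain ⟨⟨hw1, hwζ⟩, hwΩ⟩ := hw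
  have hζw : ⟪ζ, w⟫ = 0 := by rw [real_inner_comm]; exact hwζ
  have hχw : χ.symm w = w := by rw [LinearIsometryEquiv.symm_apply_eq]; exact hχ.1.symm
  have hχsymm : ∀ θ, ⟪θ, w⟫ = 0 → ⟪χ.symm θ, w⟫ = 0 := fun θ hθ => by
    conv_lhs => rw [← hχw]
    rw [χ.symm.inner_map_map, hθ]
  have hsupp : ∀ θ, ⟪θ, w⟫ = 0 → suppFn K (χ.symm θ) = suppFn L θ + ⟪θ, a⟫ := fun θ hθ => by
    have h := congrArg (fun D => suppFn D θ) himg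
    rwa [suppFn_isometry_image, suppFn_projHyp K (hχsymm θ hθ),
      suppFn_translate (hL.1.image (continuous_projHyp w)) (hLne.image _),
      suppFn_projHyp L hθ] at h
  have hwidthL : widthFn L ζ = 2 * r := hζL.2.trans hLmax
  have hwidthK : widthFn K ζ = 2 * r := hζK.2.trans hKmax
  have hmem : χ.symm ζ ∈ (DiamDirs K ∪ DiamDirs L) ∩ S2 w := by
    have hs : χ.symm ζ ∈ sph := by simpa [sph] using hζ1
    refine ⟨Or.inl ⟨hs, ?_⟩, hs, hχsymm ζ hζw⟩
    rw [hKmax, ← hwidthL, widthFn, widthFn, ← map_neg, hsupp ζ hζw,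
      hsupp (-ζ) (by rw [inner_neg_left, hζw, neg_zero]), inner_neg_left]
    ring
  rw [hwΩ] at hmem
  have hsign : χ.symm ζ = ζ ∨ χ.symm ζ = -ζ := hmem
  refine ⟨hsign, ?_⟩
  set b : E4 := a + χ aK - aL with hb
  have hsuppt : ∀ θ, ⟪θ, w⟫ = 0 → suppFn ((fun x => x + aK) '' K) (χ.symm θ) =
      suppFn ((fun x => x + aL) '' L) θ + ⟪θ, b⟫ := fun θ hθ => by
    have : ⟪χ.symm θ, aK⟫ = ⟪θ, χ aK⟫ := by
      rw [← χ.inner_map_map (χ.symm θ) aK, χ.apply_symm_apply]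
    rw [suppFn_translate hK.1 hKne, suppFn_translate hL.1 hLne, hsupp θ hθ, this, hb,
      inner_sub_right, inner_add_right]
    ring
  have hLζ := suppFn_eq_of_diam hLt hζ1 (by rw [widthFn_translate hL.1 hLne, hwidthL]) hLneg hLpos
  have hKζ := suppFn_eq_of_diam hKt hζ1 (by rw [widthFn_translate hK.1 hKne, hwidthK]) hKneg hKpos
  have hKζ' := suppFn_eq_of_diam (u := -ζ) hKt (by rw [norm_neg, hζ1])
    (by rw [widthFn_translate hK.1 hKne, ← hwidthK, widthFn, widthFn, neg_neg, add_comm])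
    (by rwa [smul_neg, neg_neg]) (by rwa [smul_neg])
  have hbζ : ⟪ζ, b⟫ = 0 := by
    have h := hsuppt ζ hζw
    rw [hLζ] at h
    rcases hsign with h' | h' <;> rw [h'] at h
    · rw [hKζ] at h; linarith
    · rw [hKζ'] at h; linarith
  have hbθ : ∀ θ, ⟪θ, w⟫ = 0 → ⟪θ, b⟫ = 0 := by
    intro θ hθ
    -- The endpoint of the diameter of the translate of `K` mapped to `rζ`.
    have hx : r • χ.symm ζ ∈ (fun x => x + aK) '' K := by
      rcases hsign with h' | h' <;> rw [h']
      · exact hKpos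
      · rwa [smul_neg]
    obtain ⟨x, hxK, hx⟩ := hx
    obtain ⟨_, ⟨y, hyL, rfl⟩, hy⟩ :
        χ (projHyp w x) ∈ (fun x => x + a) '' (projHyp w '' L) :=
      himg ▸ ⟨_, ⟨x, hxK, rfl⟩, rfl⟩
    have hinner : ∀ η, ⟪η, w⟫ = 0 → ⟪η, y + aL⟫ + ⟪η, b⟫ = r * ⟪η, ζ⟫ := by
      intro η hη
      have h1 : ⟪η, χ (projHyp w x)⟫ = ⟪η, χ x⟫ := by
        rw [← χ.symm.inner_map_map, ← χ.symm.inner_map_map η (χ x), χ.symm_apply_apply,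
          χ.symm_apply_apply, inner_projHyp (hχsymm η hη)]
      have h2 : χ x + χ aK = r • ζ := by
        rw [← map_add, show x + aK = r • χ.symm ζ from hx, map_smul, χ.apply_symm_apply]
      have h3 := congrArg (fun v => ⟪η, v⟫) h2
      simp only [inner_add_right, real_inner_smul_right] at h3
      rw [← hy, inner_add_right, inner_projHyp hη] at h1
      rw [hb, inner_sub_right, inner_add_right, inner_add_right]
      linarith
    have hyζ : y + aL = r • ζ := by
      refine eq_smul_of_inner_eq hLt hr hζ1 hLdist.symm hLneg ⟨y, hyL, rfl⟩ ?_
      have h := hinner ζ hζw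
      rw [hbζ, real_inner_self_eq_norm_sq, hζ1] at h
      rw [real_inner_comm]
      linarith
    have h := hinner θ hθ
    rw [hyζ, real_inner_smul_right] at h
    linarith
  intro θ hθ
  rw [hsuppt θ hθ.2, hbθ θ hθ.2, add_zero]
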